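/- arXiv:2605.04272 — 2 statements merged into one kernel-verified Lean document; each statement's English description precedes it below -/
import Mathlib

section
/- Let u, v ∈ Ĥ^{p,q} with v ≠ u and v ≠ −u. Then ⟨u,v⟩ < 1 if and only if there exist w ∈ ℝ^{p+q+1} with ⟨u,w⟩ = 0 and t ∈ ℝ such that one of the following holds: (i) ⟨w,w⟩ = 1 and v = cosh(t)·u + sinh(t)·w; (ii) ⟨w,w⟩ = 0 and v = u + t·w; (iii) ⟨w,w⟩ = −1 and v = cos(t)·u + sin(t)·w. (That is, two such points are joined by a geodesic of Ĥ^{p,q} exactly when ⟨u,v⟩ < 1.) -/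
/-- Two points `u ≠ ±v` of `Ĥ^{p,q}` are joined by a geodesic (spacelike, lightlike
or timelike) exactly when `⟨u,v⟩ < 1`. -/
theorem joined_by_geodesic_iff_inner_lt_one
    (p q : ℕ) (hp : 1 ≤ p)
    (B : (Fin (p + q + 1) → ℝ) → (Fin (p + q + 1) → ℝ) → ℝ)
    (hB : B = fun x y => ∑ i : Fin (p + q + 1),
      if (i : ℕ) < p then x i * y i else -(x i * y i))
    (u v : Fin (p + q + 1) → ℝ)
    (hu : B u u = -1) (hv : B v v = -1)
    (hne : v ≠ u) (hne' : v ≠ -u) :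
    B u v < 1 ↔
      ∃ (w : Fin (p + q + 1) → ℝ) (t : ℝ), B u w = 0 ∧
        ((B w w = 1 ∧ v = Real.cosh t • u + Real.sinh t • w) ∨
         (B w w = 0 ∧ v = u + t • w) ∨
         (B w w = -1 ∧ v = Real.cos t • u + Real.sin t • w)) := by
  have comm (x y) : B x y = B y x := by
    subst hB
    simp only [mul_comm]
  have lin (x y z : Fin (p + q + 1) → ℝ) (a b : ℝ) :
      B x (a • y + b • z) = a * B x y + b * B x z := by
    subst hB
    simp only [Finset.mul_sum, ← Finset.sum_add_distrib]
    refine Finset.sum_congr rfl fun i _ => ?_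
    simp only [Pi.add_apply, Pi.smul_apply, smul_eq_mul]
    split_ifs <;> ring
  constructor
  · intro h
    obtain ⟨a, ha⟩ : ∃ a, a = -B u v := ⟨_, rfl⟩
    have huv : B u v = -a := by linarith
    have orth (s : ℝ) : B u (s • v + (-(s * a)) • u) = 0 := by
      rw [lin, huv, hu]
      ring
    have norm (s : ℝ) : B (s • v + (-(s * a)) • u) (s • v + (-(s * a)) • u) =
        s ^ 2 * (a ^ 2 - 1) := by
      rw [lin, comm _ u, orth, comm _ v, lin, hv, comm v u, huv]
      ring
    have combine {s r : ℝ} (hrs : r * s = 1) :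
        v = a • u + r • (s • v + (-(s * a)) • u) := by
      ext i
      simp only [Pi.add_apply, Pi.smul_apply, smul_eq_mul]
      linear_combination (a * u i - v i) * hrs
    rcases lt_trichotomy a 1 with h1 | h1 | h1
    · have hcos : Real.cos (Real.arccos a) = a := Real.cos_arccos (by linarith) h1.le
      have hsin : Real.sin (Real.arccos a) ≠ 0 := by
        intro h0
        have := Real.sin_sq_add_cos_sq (Real.arccos a)
        rw [h0, hcos] at this
        nlinarith
      refine ⟨_, Real.arccos a, orth (Real.sin (Real.arccos a))⁻¹, Or.inr (Or.inr ⟨?_, ?_⟩)⟩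
      · rw [norm]
        have := Real.sin_sq_add_cos_sq (Real.arccos a)
        rw [hcos] at this
        field_simp
        linarith
      · rw [hcos]
        exact combine (mul_inv_cancel₀ hsin)
    · refine ⟨_, 1, orth 1, Or.inr (Or.inl ⟨?_, ?_⟩)⟩
      · rw [norm, h1]
        norm_num
      · have := combine (mul_one (1 : ℝ))
        rwa [show a • u = u by rw [h1, one_smul]] at this
    · have hcosh : Real.cosh (Real.arcosh a) = a := Real.cosh_arcosh h1.le
      have hsq := Real.cosh_sq (Real.arcosh a)
      rw [hcosh] at hsq
      have hsinh : Real.sinh (Real.arcosh a) ≠ 0 := by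
        intro h0
        rw [h0] at hsq
        nlinarith
      refine ⟨_, Real.arcosh a, orth (Real.sinh (Real.arcosh a))⁻¹, Or.inl ⟨?_, ?_⟩⟩
      · rw [norm]
        field_simp
        linarith
      · rw [hcosh]
        exact combine (mul_inv_cancel₀ hsinh)
  · rintro ⟨w, t, hw, ⟨-, h⟩ | ⟨-, h⟩ | ⟨-, h⟩⟩
    · rw [h, lin, hu, hw]
      linarith [Real.cosh_pos t]
    · rw [h, ← one_smul ℝ u, lin, one_smul, hu, hw]
      norm_num
    · have hcos : Real.cos t ≠ -1 := by
        intro hc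
        have hs : Real.sin t = 0 := by
          have := Real.sin_sq_add_cos_sq t
          rw [hc] at this
          nlinarith
        exact hne' (by rw [h, hc, hs]; simp)
      rw [h, lin, hu, hw]
      linarith [lt_of_le_of_ne (Real.neg_one_le_cos t) hcos.symm]
end

section
/- Let 0 < ε < 1 and set d = √(1 − ε²). Let T > 0 and let u : [0,T] → ℝ be differentiable with u(0) = 0, u(t) ≥ 0 for all t, and |u'(t)| ≤ 2·u(t) + ε·(1 + u(t)²) for all t ∈ [0,T]. Then for every t ∈ [0,T] with e^{2dt} < (1+d)/(1−d), one has u(t) ≤ (1/ε) · (e^{2dt} − 1) / ( 1/(1−d) − e^{2dt}/(1+d) ). -/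
/-- A nonnegative function vanishing at `0` whose derivative satisfies the Riccati-type
bound `|u'| ≤ 2u + ε(1+u²)` is dominated by the explicit solution of the Riccati
equation, divided by `ε`. -/
theorem riccati_comparison
    (ε : ℝ) (hε0 : 0 < ε) (hε1 : ε < 1)
    (d : ℝ) (hd : d = Real.sqrt (1 - ε ^ 2))
    (T : ℝ) (hT : 0 < T)
    (u u' : ℝ → ℝ)
    (hu0 : u 0 = 0)
    (hpos : ∀ t ∈ Set.Icc (0 : ℝ) T, 0 ≤ u t)
    (hderiv : ∀ t ∈ Set.Icc (0 : ℝ) T, HasDerivAt u (u' t) t)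
    (hbound : ∀ t ∈ Set.Icc (0 : ℝ) T, |u' t| ≤ 2 * u t + ε * (1 + (u t) ^ 2)) :
    ∀ t ∈ Set.Icc (0 : ℝ) T, Real.exp (2 * d * t) < (1 + d) / (1 - d) →
      u t ≤ (1 / ε) * (Real.exp (2 * d * t) - 1) /
        (1 / (1 - d) - Real.exp (2 * d * t) / (1 + d)) := by
  have hdsq : d ^ 2 = 1 - ε ^ 2 := by
    rw [hd]
    exact Real.sq_sqrt (by nlinarith)
  have hd0 : 0 < d := by
    rw [hd]
    exact Real.sqrt_pos.mpr (by nlinarith)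
  have hd1 : d < 1 := by nlinarith
  -- `-1 ± d` are the roots of the Riccati quadratic `w² + 2w + ε²`, so the ratio of the two
  -- linear factors grows at most like `exp (2dt)`.
  set r : ℝ → ℝ := fun s =>
    (ε * u s + 1 - d) / (ε * u s + 1 + d) * Real.exp (-(2 * d * s)) with hr
  have hden : ∀ s ∈ Set.Icc (0 : ℝ) T, 0 < ε * u s + 1 + d := fun s hs => by
    have := mul_nonneg hε0.le (hpos s hs)
    linarith
  have hr' : ∀ s ∈ Set.Icc (0 : ℝ) T, HasDerivAt r
      (2 * d * (ε * u' s - (ε * u s + 1 - d) * (ε * u s + 1 + d)) / (ε * u s + 1 + d) ^ 2 *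
        Real.exp (-(2 * d * s))) s := fun s hs => by
    have hw := (hderiv s hs).const_mul ε
    have hq := ((hw.add_const 1).sub_const d).div ((hw.add_const 1).add_const d) (hden s hs).ne'
    have he := ((hasDerivAt_id s).const_mul (2 * d)).neg.exp
    refine (hq.mul he).congr_deriv ?_
    have := (hden s hs).ne'
    simp only [id, Pi.neg_apply, Pi.div_apply]
    field_simp
    ring
  have hanti : AntitoneOn r (Set.Icc 0 T) := by
    refine antitoneOn_of_hasDerivWithinAt_nonpos (convex_Icc 0 T)
      (fun s hs => (hr' s hs).continuousAt.continuousWithinAt)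
      (fun s hs => (hr' s (interior_subset hs)).hasDerivWithinAt) fun s hs => ?_
    have hs := interior_subset hs
    refine mul_nonpos_of_nonpos_of_nonneg (div_nonpos_of_nonpos_of_nonneg ?_ (sq_nonneg _))
      (Real.exp_pos _).le
    have h := mul_le_mul_of_nonneg_left ((le_abs_self _).trans (hbound s hs)) hε0.le
    refine mul_nonpos_of_nonneg_of_nonpos (by linarith) ?_
    linarith
  intro t ht hlt
  have hrt := hanti (Set.left_mem_Icc.mpr hT.le) ht ht.1
  simp only [hr, hu0, mul_zero, zero_add, Real.exp_zero, inv_one, mul_one, Real.exp_neg] at hrt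
  set E := Real.exp (2 * d * t)
  have hE : 0 < E := Real.exp_pos _
  rw [← div_eq_mul_inv, div_le_iff₀ hE, div_le_iff₀ (hden t ht), div_mul_eq_mul_div,
    div_mul_eq_mul_div, le_div_iff₀ (by linarith)] at hrt
  rw [lt_div_iff₀ (by linarith)] at hlt
  have h1 : 0 < 1 - d := by linarith
  have h2 : 0 < 1 + d := by linarith
  have hD : 1 / (1 - d) - E / (1 + d) = (1 + d - E * (1 - d)) / ((1 - d) * (1 + d)) := by
    field_simp
  have hDpos : 0 < 1 / (1 - d) - E / (1 + d) := by
    rw [hD]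
    exact div_pos (by linarith) (mul_pos h1 h2)
  rw [le_div_iff₀ hDpos, one_div_mul_eq_div, le_div_iff₀ hε0, hD, mul_div_assoc', div_mul_eq_mul_div,
    div_le_iff₀ (mul_pos h1 h2)]
  linarith
end
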